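/- For any bipartite density operator ρ_AB on finite-dimensional H_A ⊗ H_B and any orthonormal basis {e_j} of H_B, the measured conditional entropy dominates the quantum conditional entropy: Σ_j p_j H(ρ_{A|j}) ≥ H(ρ_AB) − H(ρ_B), where p_j = Tr((I_A ⊗ |e_j⟩⟨e_j|)ρ_AB), ρ_{A|j} = Tr_B((I_A ⊗ |e_j⟩⟨e_j|)ρ_AB)/p_j, and ρ_B = Tr_A(ρ_AB). -/

import Mathlib

open Matrix Kronecker BigOperators ComplexOrder

noncomputable section

/-- von Neumann entropy of a (Hermitian) matrix; 0 if not Hermitian. -/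
def vNEntropy {n : Type} [Fintype n] [DecidableEq n] (ρ : Matrix n n ℂ) : ℝ :=
  if h : ρ.IsHermitian then ∑ i, Real.negMulLog (h.eigenvalues i) else 0

/-- Shannon entropy of a finitely supported probability vector. -/
def shannonEntropy {ι : Type} [Fintype ι] (p : ι → ℝ) : ℝ := ∑ i, Real.negMulLog (p i)

/-- Density operator predicate. -/
def IsDensity {n : Type} [Fintype n] [DecidableEq n] (ρ : Matrix n n ℂ) : Prop :=
  ρ.PosSemidef ∧ ρ.trace = 1

/-- |v⟩⟨w| -/
def ketbra {n : Type} (v w : n → ℂ) : Matrix n n ℂ := fun i j => v i * star (w j)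

/-- Orthonormal family. -/
def OrthoFam {ι n : Type} [Fintype n] [DecidableEq ι] (v : ι → n → ℂ) : Prop :=
  ∀ j k, (∑ i, star (v j i) * v k i) = if j = k then 1 else 0

/-- Partial trace over the first (A) factor. -/
def ptrA {dA dB : Type} [Fintype dA] (ρ : Matrix (dA × dB) (dA × dB) ℂ) : Matrix dB dB ℂ :=
  fun b b' => ∑ a, ρ (a, b) (a, b')

/-- Partial trace over the second (B) factor. -/
def ptrB {dA dB : Type} [Fintype dB] (ρ : Matrix (dA × dB) (dA × dB) ℂ) : Matrix dA dA ℂ :=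
  fun a a' => ∑ b, ρ (a, b) (a', b)

/-- Outcome probability for POVM element E on B. -/
def pOf {dA dB : Type} [Fintype dA] [Fintype dB] [DecidableEq dA]
    (ρ : Matrix (dA × dB) (dA × dB) ℂ) (E : Matrix dB dB ℂ) : ℝ :=
  (((1 : Matrix dA dA ℂ) ⊗ₖ E * ρ).trace).re

/-- Conditional state of A given POVM element E on B. -/
def condState {dA dB : Type} [Fintype dA] [Fintype dB] [DecidableEq dA] [DecidableEq dB]
    (ρ : Matrix (dA × dB) (dA × dB) ℂ) (E : Matrix dB dB ℂ) : Matrix dA dA ℂ :=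
  ((pOf ρ E : ℂ))⁻¹ • ptrB ((1 : Matrix dA dA ℂ) ⊗ₖ E * ρ)

/-- Set of measured conditional entropies over rank-1 POVMs on B. -/
def measuredCondEntropies {dA dB : Type} [Fintype dA] [Fintype dB] [DecidableEq dA] [DecidableEq dB]
    (ρ : Matrix (dA × dB) (dA × dB) ℂ) : Set ℝ :=
  { x | ∃ (m : ℕ) (M : Fin m → Matrix dB dB ℂ),
      (∀ i, (M i).PosSemidef) ∧ (∀ i, (M i).rank ≤ 1) ∧ (∑ i, M i = 1) ∧
      x = ∑ i, pOf ρ (M i) * vNEntropy (condState ρ (M i)) }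

/-- Quantum discord with measurements on B. -/
def discord {dA dB : Type} [Fintype dA] [Fintype dB] [DecidableEq dA] [DecidableEq dB]
    (ρ : Matrix (dA × dB) (dA × dB) ℂ) : ℝ :=
  vNEntropy (ptrA ρ) - vNEntropy ρ + sInf (measuredCondEntropies ρ)

/-- The B-contraction ⟨e_j| ρ |e_k⟩ as operator on A. -/
def bContract {dA dB : Type} [Fintype dB]
    (ρ : Matrix (dA × dB) (dA × dB) ℂ) (u v : dB → ℂ) : Matrix dA dA ℂ :=
  fun a a' => ∑ b, ∑ b', star (u b) * ρ (a, b) (a', b') * v b'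

/-- Extended state ρ'_ABC from measuring B in basis e, recorded in C with family f. -/
def extState {dA dB dC : Type} [Fintype dA] [Fintype dB] [Fintype dC]
    (ρ : Matrix (dA × dB) (dA × dB) ℂ) (e : dB → dB → ℂ) (f : dB → dC → ℂ) :
    Matrix (dA × dB × dC) (dA × dB × dC) ℂ :=
  fun x y => ∑ j, ∑ k,
    bContract ρ (e j) (e k) x.1 y.1 * e j x.2.1 * star (e k y.2.1) * f j x.2.2 * star (f k y.2.2)

/-- Partial trace over C for a tripartite A ⊗ B ⊗ C matrix. -/
def ptrC3 {dA dB dC : Type} [Fintype dC]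
    (ρ : Matrix (dA × dB × dC) (dA × dB × dC) ℂ) : Matrix (dA × dB) (dA × dB) ℂ :=
  fun x y => ∑ c, ρ (x.1, x.2, c) (y.1, y.2, c)

/-- Partial trace over A for a tripartite matrix. -/
def ptrA3 {dA dB dC : Type} [Fintype dA]
    (ρ : Matrix (dA × dB × dC) (dA × dB × dC) ℂ) : Matrix (dB × dC) (dB × dC) ℂ :=
  fun x y => ∑ a, ρ (a, x.1, x.2) (a, y.1, y.2)

/-- Partial trace over both A and C. -/
def ptrAC3 {dA dB dC : Type} [Fintype dA] [Fintype dC]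
    (ρ : Matrix (dA × dB × dC) (dA × dB × dC) ℂ) : Matrix dB dB ℂ :=
  fun b b' => ∑ a, ∑ c, ρ (a, b, c) (a, b', c)


open Filter Topology

lemma tendsto_mul_log_add_mul_sub_mul_log_atTop {p q : ℝ} (hp : 0 ≤ p) (hq : 0 ≤ q) :
    Tendsto (fun t : ℝ => p * Real.log (q + t * p) - p * Real.log t) atTop
      (𝓝 (p * Real.log p)) := by
  rcases hp.eq_or_lt with rfl | hp
  · simp
  have h1 : Tendsto (fun t : ℝ => q / t + p) atTop (𝓝 (0 + p)) :=
    (tendsto_const_nhds.div_atTop tendsto_id).add_const p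
  rw [zero_add] at h1
  refine ((h1.log hp.ne').const_mul p).congr' ?_
  filter_upwards [eventually_gt_atTop 0] with t ht
  have : q + t * p = t * (q / t + p) := by field_simp
  rw [this, Real.log_mul ht.ne' (by positivity)]
  ring

lemma tendsto_mul_log_add_mul_nhdsGT_zero {c p q : ℝ} (hq : 0 ≤ q) (h : q = 0 → c = 0) :
    Tendsto (fun t : ℝ => c * Real.log (q + t * p)) (𝓝[>] 0) (𝓝 (c * Real.log q)) := by
  rcases hq.eq_or_lt with rfl | hq
  · simp [h rfl]
  have h1 : Tendsto (fun t : ℝ => q + t * p) (𝓝[>] 0) (𝓝 q) := by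
    have : Continuous fun t : ℝ => q + t * p := by fun_prop
    simpa using (this.tendsto 0).mono_left nhdsWithin_le_nhds
  exact (h1.log hq.ne').const_mul c

lemma hasDerivAt_mul_log_add_mul {c p q t : ℝ} (hp : 0 ≤ p) (hq : 0 ≤ q) (ht : 0 < t)
    (h : p = 0 → c = 0) :
    HasDerivAt (fun t : ℝ => c * Real.log (q + t * p)) (c * p / (q + t * p)) t := by
  rcases hp.eq_or_lt with rfl | hp
  · simpa [h rfl] using hasDerivAt_const t (0 : ℝ)
  have h1 : HasDerivAt (fun t : ℝ => q + t * p) p t := by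
    simpa using ((hasDerivAt_id t).mul_const p).const_add q
  simpa [mul_div_assoc] using (h1.log (by positivity)).const_mul c

/-- Comparison of relative entropies from the comparison of their resolvent integrands at
every `t > 0`. -/
lemma sum_mul_log_sub_le_of_resolvent {ι κ : Type*} [Fintype ι] [Fintype κ]
    (c p q : ι → ℝ) (r s : κ → ℝ) (hp : ∀ i, 0 ≤ p i) (hq : ∀ i, 0 ≤ q i)
    (hr : ∀ k, 0 ≤ r k) (hs : ∀ k, 0 ≤ s k)
    (hcq : ∀ i, q i = 0 → p i * c i = 0) (hrs : ∀ k, s k = 0 → r k = 0)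
    (hsum : ∑ k, r k = ∑ i, p i * c i)
    (hres : ∀ t : ℝ, 0 < t →
      ∑ k, r k * r k / (s k + t * r k) ≤ ∑ i, p i * c i * p i / (q i + t * p i)) :
    ∑ i, p i * c i * Real.log (q i) - ∑ k, r k * Real.log (s k) ≤
      ∑ i, p i * c i * Real.log (p i) - ∑ k, r k * Real.log (r k) := by
  set G : ℝ → ℝ := fun t =>
    ∑ i, p i * c i * Real.log (q i + t * p i) - ∑ k, r k * Real.log (s k + t * r k) with hG
  have hderiv : ∀ t, 0 < t → HasDerivAt G
      (∑ i, p i * c i * p i / (q i + t * p i) - ∑ k, r k * r k / (s k + t * r k)) t := by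
    intro t ht
    refine HasDerivAt.sub (HasDerivAt.fun_sum fun i _ => ?_) (HasDerivAt.fun_sum fun k _ => ?_)
    · exact hasDerivAt_mul_log_add_mul (hp i) (hq i) ht (by simp +contextual)
    · exact hasDerivAt_mul_log_add_mul (hr k) (hs k) ht id
  have hmono : MonotoneOn G (Set.Ioi 0) := by
    refine monotoneOn_of_hasDerivWithinAt_nonneg (convex_Ioi 0)
      (fun t ht => (hderiv t ht).continuousAt.continuousWithinAt)
      (fun t ht => (hderiv t (by simpa using ht)).hasDerivWithinAt) fun t ht => ?_
    exact sub_nonneg.2 (hres t (by simpa using ht))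
  have htop : Tendsto G atTop
      (𝓝 (∑ i, p i * c i * Real.log (p i) - ∑ k, r k * Real.log (r k))) := by
    have h1 : Tendsto (fun t : ℝ =>
        ∑ i, c i * (p i * Real.log (q i + t * p i) - p i * Real.log t) -
        ∑ k, (r k * Real.log (s k + t * r k) - r k * Real.log t)) atTop
        (𝓝 (∑ i, c i * (p i * Real.log (p i)) - ∑ k, r k * Real.log (r k))) :=
      (tendsto_finsetSum _ fun i _ =>
        (tendsto_mul_log_add_mul_sub_mul_log_atTop (hp i) (hq i)).const_mul (c i)).sub
      (tendsto_finsetSum _ fun k _ => tendsto_mul_log_add_mul_sub_mul_log_atTop (hr k) (hs k))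
    convert h1 using 2 with t
    · have e1 : ∑ i, c i * (p i * Real.log (q i + t * p i) - p i * Real.log t) =
          ∑ i, p i * c i * Real.log (q i + t * p i) - (∑ i, p i * c i) * Real.log t := by
        rw [Finset.sum_mul, ← Finset.sum_sub_distrib]
        exact Finset.sum_congr rfl fun i _ => by ring
      rw [e1, Finset.sum_sub_distrib, ← Finset.sum_mul, hsum, hG]
      ring
    · congr 1
      exact Finset.sum_congr rfl fun i _ => by ring
  have hzero : Tendsto G (𝓝[>] 0)
      (𝓝 (∑ i, p i * c i * Real.log (q i) - ∑ k, r k * Real.log (s k))) :=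
    (tendsto_finsetSum _ fun i _ => tendsto_mul_log_add_mul_nhdsGT_zero (hq i) (hcq i)).sub
    (tendsto_finsetSum _ fun k _ => tendsto_mul_log_add_mul_nhdsGT_zero (hs k) (hrs k))
  refine le_of_tendsto hzero ?_
  filter_upwards [self_mem_nhdsWithin] with t ht
  refine ge_of_tendsto htop ?_
  filter_upwards [eventually_ge_atTop t] with u hu
  exact hmono ht (lt_of_lt_of_le ht hu) hu

lemma two_mul_re_sub_le {p q t : ℝ} (hp : 0 ≤ p) (hq : 0 ≤ q) (ht : 0 < t) (u x : ℂ) :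
    2 * (p * (star u * x).re) - (q + t * p) * ‖x‖ ^ 2 ≤ p * ‖u‖ ^ 2 * p / (q + t * p) := by
  rcases hp.eq_or_lt with rfl | hp
  · simp; positivity
  have hd : 0 < q + t * p := by positivity
  rw [le_div_iff₀ hd]
  have h1 : (star u * x).re ≤ ‖u‖ * ‖x‖ := by
    simpa using Complex.re_le_norm (star u * x)
  nlinarith [sq_nonneg (p * ‖u‖ - (q + t * p) * ‖x‖),
    mul_le_mul_of_nonneg_left h1 (mul_pos hp hd).le]

lemma sum_norm_sq_row {n : Type*} [Fintype n] (M : Matrix n n ℂ) (i : n) :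
    ((∑ j, ‖M i j‖ ^ 2 : ℝ) : ℂ) = (M * Mᴴ) i i := by
  simp [Matrix.mul_apply, Complex.mul_conj']

lemma sum_norm_sq_col {n : Type*} [Fintype n] (M : Matrix n n ℂ) (j : n) :
    ((∑ i, ‖M i j‖ ^ 2 : ℝ) : ℂ) = (Mᴴ * M) j j := by
  simp [Matrix.mul_apply, Complex.conj_mul']

lemma mul_diagonal_mul_conjTranspose_apply_self {n : Type*} [Fintype n] [DecidableEq n]
    (M : Matrix n n ℂ) (x : n → ℝ) (i : n) :
    (M * diagonal (fun k => (x k : ℂ)) * Mᴴ) i i = ((∑ k, x k * ‖M i k‖ ^ 2 : ℝ) : ℂ) := by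
  rw [Matrix.mul_apply]
  simp only [mul_diagonal, conjTranspose_apply]
  push_cast
  refine Finset.sum_congr rfl fun k _ => ?_
  rw [← Complex.mul_conj', mul_right_comm, mul_comm, RCLike.star_def]

lemma sum_resolvent_le {n : Type*} [Fintype n] [DecidableEq n] (A B : Matrix n n ℂ)
    (hA : Aᴴ * A = 1) (hB : B * Bᴴ = 1)
    (p q : n → ℝ) (hp : ∀ i, 0 ≤ p i) (hq : ∀ i, 0 ≤ q i) {t : ℝ} (ht : 0 < t)
    (r s : n → ℝ) (hr : ∀ k, r k = ∑ i, p i * ‖B k i‖ ^ 2)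
    (hs : ∀ k, s k = ∑ m, q m * ‖A m k‖ ^ 2) :
    ∑ k, r k * r k / (s k + t * r k) ≤
      ∑ m, ∑ i, p i * ‖(A * B) m i‖ ^ 2 * p i / (q m + t * p i) := by
  have hr0 : ∀ k, 0 ≤ r k := fun k => by
    rw [hr]; exact Finset.sum_nonneg fun i _ => mul_nonneg (hp i) (by positivity)
  have hs0 : ∀ k, 0 ≤ s k := fun k => by
    rw [hs]; exact Finset.sum_nonneg fun i _ => mul_nonneg (hq i) (by positivity)
  set x : n → ℝ := fun k => r k / (s k + t * r k) with hx
  set D : Matrix n n ℂ := diagonal fun k => (x k : ℂ) with hD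
  have hDD : D * D = diagonal fun k => ((x k ^ 2 : ℝ) : ℂ) := by
    rw [hD, diagonal_mul_diagonal]; simp [sq]
  have hDh : Dᴴ = D := by
    rw [hD, diagonal_conjTranspose]; congr 1; ext k; simp
  set M : Matrix n n ℂ := A * D * B with hM
  have hrow : ∀ m, ∑ i, ‖M m i‖ ^ 2 = ∑ k, x k ^ 2 * ‖A m k‖ ^ 2 := by
    intro m
    have : M * Mᴴ = A * diagonal (fun k => ((x k ^ 2 : ℝ) : ℂ)) * Aᴴ := by
      rw [← hDD, hM, conjTranspose_mul, conjTranspose_mul, hDh]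
      calc _ = A * D * (B * Bᴴ) * D * Aᴴ := by simp only [Matrix.mul_assoc]
        _ = _ := by rw [hB]; simp only [Matrix.mul_assoc, Matrix.one_mul]
    have h2 := sum_norm_sq_row M m
    rw [this, mul_diagonal_mul_conjTranspose_apply_self] at h2
    exact_mod_cast h2
  have hcol : ∀ i, ∑ m, ‖M m i‖ ^ 2 = ∑ k, x k ^ 2 * ‖B k i‖ ^ 2 := by
    intro i
    have : Mᴴ * M = Bᴴ * diagonal (fun k => ((x k ^ 2 : ℝ) : ℂ)) * Bᴴᴴ := by
      rw [← hDD, hM, conjTranspose_mul, conjTranspose_mul, hDh, conjTranspose_conjTranspose]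
      calc _ = Bᴴ * D * (Aᴴ * A) * D * B := by simp only [Matrix.mul_assoc]
        _ = _ := by rw [hA]; simp only [Matrix.mul_assoc, Matrix.one_mul]
    have h2 := sum_norm_sq_col M i
    rw [this, mul_diagonal_mul_conjTranspose_apply_self] at h2
    simp only [conjTranspose_apply, norm_star] at h2
    exact_mod_cast h2
  have hcross : ∀ i, ∑ m, (star ((A * B) m i) * M m i).re = ∑ k, x k * ‖B k i‖ ^ 2 := by
    intro i
    have h1 : (A * B)ᴴ * M = Bᴴ * D * Bᴴᴴ := by
      rw [hM, conjTranspose_mul, conjTranspose_conjTranspose]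
      calc _ = Bᴴ * (Aᴴ * A) * D * B := by simp only [Matrix.mul_assoc]
        _ = _ := by rw [hA]; simp only [Matrix.mul_one]
    have h2 : ∑ m, star ((A * B) m i) * M m i = ((A * B)ᴴ * M) i i := by
      rw [Matrix.mul_apply]; rfl
    rw [h1, hD, mul_diagonal_mul_conjTranspose_apply_self] at h2
    simp only [conjTranspose_apply, norm_star] at h2
    rw [← Complex.re_sum, h2, Complex.ofReal_re]
  have key : ∑ m, ∑ i, (2 * (p i * (star ((A * B) m i) * M m i).re)
      - (q m + t * p i) * ‖M m i‖ ^ 2) = ∑ k, r k * r k / (s k + t * r k) := by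
    have e1 : ∑ m, ∑ i, (2 * (p i * (star ((A * B) m i) * M m i).re)
        - (q m + t * p i) * ‖M m i‖ ^ 2) =
        2 * ∑ i, p i * ∑ m, (star ((A * B) m i) * M m i).re - ∑ m, q m * ∑ i, ‖M m i‖ ^ 2
        - t * ∑ i, p i * ∑ m, ‖M m i‖ ^ 2 := by
      simp only [Finset.mul_sum]
      rw [Finset.sum_comm (f := fun i m => 2 * (p i * (star ((A * B) m i) * M m i).re)),
        Finset.sum_comm (f := fun i m => t * (p i * ‖M m i‖ ^ 2))]
      simp only [← Finset.sum_sub_distrib]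
      exact Finset.sum_congr rfl fun m _ => Finset.sum_congr rfl fun i _ => by ring
    have swap : ∀ (y : n → ℝ) (c : n → ℝ) (N : n → n → ℝ),
        ∑ i, c i * ∑ k, y k * N k i = ∑ k, y k * ∑ i, c i * N k i := by
      intro y c N
      simp only [Finset.mul_sum]
      rw [Finset.sum_comm]
      exact Finset.sum_congr rfl fun m _ => Finset.sum_congr rfl fun i _ => by ring
    rw [e1]
    simp only [hrow, hcol, hcross]
    rw [swap x p fun k i => ‖B k i‖ ^ 2, swap (fun k => x k ^ 2) q fun k m => ‖A m k‖ ^ 2,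
      swap (fun k => x k ^ 2) p fun k i => ‖B k i‖ ^ 2]
    simp only [← hr, ← hs]
    rw [Finset.mul_sum, Finset.mul_sum, ← Finset.sum_sub_distrib, ← Finset.sum_sub_distrib]
    refine Finset.sum_congr rfl fun k _ => ?_
    rcases (hr0 k).eq_or_lt with h | h
    · simp [hx, ← h]
    · have : 0 < s k + t * r k := add_pos_of_nonneg_of_pos (hs0 k) (by positivity)
      have hxk : x k * (s k + t * r k) = r k := div_mul_cancel₀ _ this.ne'
      have : r k * r k / (s k + t * r k) = x k * r k := by rw [mul_div_right_comm]
      rw [this]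
      linear_combination -(x k) * hxk
  rw [← key]
  exact Finset.sum_le_sum fun m _ => Finset.sum_le_sum fun i _ =>
    two_mul_re_sub_le (hp i) (hq m) ht _ _

/-- Relative entropy decreases under a measurement in an orthonormal basis; here `p` and `q` are the
spectra of the two states, `A * B` is the overlap matrix of their eigenbases, and `r` and `s` are the
outcome distributions. -/
lemma measured_relative_entropy_le {n : Type*} [Fintype n] [DecidableEq n] (A B : Matrix n n ℂ)
    (hA : Aᴴ * A = 1) (hB : B * Bᴴ = 1)
    (p q : n → ℝ) (hp : ∀ i, 0 ≤ p i) (hq : ∀ i, 0 ≤ q i)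
    (r s : n → ℝ) (hr : ∀ k, r k = ∑ i, p i * ‖B k i‖ ^ 2)
    (hs : ∀ k, s k = ∑ m, q m * ‖A m k‖ ^ 2)
    (hpq : ∀ m i, q m = 0 → p i * ‖(A * B) m i‖ ^ 2 = 0) (hrs : ∀ k, s k = 0 → r k = 0) :
    ∑ m, (∑ i, p i * ‖(A * B) m i‖ ^ 2) * Real.log (q m) - ∑ k, r k * Real.log (s k) ≤
      ∑ i, p i * Real.log (p i) - ∑ k, r k * Real.log (r k) := by
  have hB' : Bᴴ * B = 1 := mul_eq_one_comm.1 hB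
  have hBcol : ∀ i, ∑ k, ‖B k i‖ ^ 2 = 1 := fun i => by
    have h := sum_norm_sq_col B i
    rw [hB', one_apply_eq] at h
    exact_mod_cast h
  have hABcol : ∀ i, ∑ m, ‖(A * B) m i‖ ^ 2 = 1 := fun i => by
    have h := sum_norm_sq_col (A * B) i
    rw [conjTranspose_mul, Matrix.mul_assoc, ← Matrix.mul_assoc Aᴴ, hA, Matrix.one_mul, hB',
      one_apply_eq] at h
    exact_mod_cast h
  have hr0 : ∀ k, 0 ≤ r k := fun k => by
    rw [hr]; exact Finset.sum_nonneg fun i _ => mul_nonneg (hp i) (by positivity)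
  have hs0 : ∀ k, 0 ≤ s k := fun k => by
    rw [hs]; exact Finset.sum_nonneg fun i _ => mul_nonneg (hq i) (by positivity)
  have h := sum_mul_log_sub_le_of_resolvent (ι := n × n) (fun x => ‖(A * B) x.1 x.2‖ ^ 2)
    (fun x => p x.2) (fun x => q x.1) r s (fun x => hp x.2) (fun x => hq x.1) hr0 hs0
    (fun x => hpq x.1 x.2) hrs ?_ ?_
  · simp only [Fintype.sum_prod_type] at h
    simp only [← Finset.sum_mul] at h
    refine h.trans_eq ?_
    congr 1
    rw [Finset.sum_comm]
    refine Finset.sum_congr rfl fun i _ => ?_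
    rw [← Finset.sum_mul, ← Finset.mul_sum, hABcol, mul_one]
  · rw [Fintype.sum_prod_type_right]
    simp only [hr, ← Finset.mul_sum, hABcol]
    rw [Finset.sum_comm]
    simp only [← Finset.mul_sum, hBcol]
  · intro t ht
    rw [Fintype.sum_prod_type]
    exact sum_resolvent_le A B hA hB p q hp hq ht r s hr hs

lemma Matrix.IsHermitian.eq_eigenvectorUnitary_mul {n : Type*} [Fintype n] [DecidableEq n]
    {M : Matrix n n ℂ} (hM : M.IsHermitian) :
    M = hM.eigenvectorUnitary * diagonal (fun i => (hM.eigenvalues i : ℂ)) *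
      (hM.eigenvectorUnitary : Matrix n n ℂ)ᴴ := by
  conv_lhs => rw [hM.spectral_theorem, Unitary.conjStarAlgAut_apply]
  rfl

/-- The diagonal of `Yᴴ * M * Y` in terms of the spectrum of `M`. -/
lemma conjTranspose_mul_mul_apply_self {n : Type*} [Fintype n] [DecidableEq n] (Y V : Matrix n n ℂ)
    (p : n → ℝ) (k : n) :
    (Yᴴ * (V * diagonal (fun i => (p i : ℂ)) * Vᴴ) * Y) k k =
      ((∑ i, p i * ‖(Yᴴ * V) k i‖ ^ 2 : ℝ) : ℂ) := by
  rw [← mul_diagonal_mul_conjTranspose_apply_self]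
  simp only [conjTranspose_mul, conjTranspose_conjTranspose, Matrix.mul_assoc]

lemma posSemidef_bContract {dA dB : Type} [Fintype dA] [Fintype dB]
    {ρ : Matrix (dA × dB) (dA × dB) ℂ} (hρ : ρ.PosSemidef) (v : dB → ℂ) :
    (bContract ρ v v).PosSemidef := by
  classical
  have h := hρ.conjTranspose_mul_mul_same
    (Matrix.of fun (x : dA × dB) (a : dA) => if x.1 = a then v x.2 else 0)
  convert h using 1
  ext a a'
  simp only [bContract, Matrix.mul_apply, conjTranspose_apply, Fintype.sum_prod_type, of_apply,
    Finset.sum_mul]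
  rw [Finset.sum_eq_single a' (by intro b _ hb; simp [hb]) (by simp), Finset.sum_comm]
  refine Finset.sum_congr rfl fun b' _ => ?_
  rw [Finset.sum_eq_single a (by intro b _ hb; simp [hb]) (by simp)]
  simp

lemma ptrB_one_kronecker_ketbra_mul {dA dB : Type} [Fintype dA] [DecidableEq dA] [Fintype dB]
    (ρ : Matrix (dA × dB) (dA × dB) ℂ) (v : dB → ℂ) :
    ptrB ((1 : Matrix dA dA ℂ) ⊗ₖ ketbra v v * ρ) = bContract ρ v v := by
  ext a a'
  simp only [ptrB, bContract, Matrix.mul_apply, kroneckerMap_apply, Fintype.sum_prod_type, ketbra,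
    Matrix.one_apply]
  rw [Finset.sum_comm, Finset.sum_eq_single a (by intro b _ hb; simp [hb.symm]) (by simp),
    Finset.sum_comm]
  refine Finset.sum_congr rfl fun b _ => Finset.sum_congr rfl fun b' _ => ?_
  simp
  ring

lemma trace_ptrB {dA dB : Type} [Fintype dA] [Fintype dB]
    (M : Matrix (dA × dB) (dA × dB) ℂ) : (ptrB M).trace = M.trace := by
  simp [Matrix.trace, ptrB, Fintype.sum_prod_type]

lemma ofReal_pOf_ketbra {dA dB : Type} [Fintype dA] [DecidableEq dA] [Fintype dB]
    {ρ : Matrix (dA × dB) (dA × dB) ℂ} (hρ : ρ.PosSemidef) (v : dB → ℂ) :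
    (pOf ρ (ketbra v v) : ℂ) = (bContract ρ v v).trace := by
  rw [pOf, ← trace_ptrB, ptrB_one_kronecker_ketbra_mul]
  exact Complex.ext rfl (Complex.nonneg_iff.1 (posSemidef_bContract hρ v).trace_nonneg).2

lemma pOf_smul_condState_ketbra {dA dB : Type} [Fintype dA] [DecidableEq dA] [Fintype dB]
    [DecidableEq dB] {ρ : Matrix (dA × dB) (dA × dB) ℂ} (hρ : ρ.PosSemidef) (v : dB → ℂ) :
    (pOf ρ (ketbra v v) : ℂ) • condState ρ (ketbra v v) = bContract ρ v v := by
  rw [condState, ptrB_one_kronecker_ketbra_mul]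
  by_cases h : (pOf ρ (ketbra v v) : ℂ) = 0
  · rw [h, zero_smul]
    rw [ofReal_pOf_ketbra hρ, (posSemidef_bContract hρ v).trace_eq_zero_iff] at h
    exact h.symm
  · rw [smul_inv_smul₀ h]

lemma pOf_ketbra_nonneg {dA dB : Type} [Fintype dA] [DecidableEq dA] [Fintype dB]
    {ρ : Matrix (dA × dB) (dA × dB) ℂ} (hρ : ρ.PosSemidef) (v : dB → ℂ) :
    0 ≤ pOf ρ (ketbra v v) := by
  have h := (posSemidef_bContract hρ v).trace_nonneg
  rw [← ofReal_pOf_ketbra hρ] at h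
  exact_mod_cast h

lemma posSemidef_condState_ketbra {dA dB : Type} [Fintype dA] [DecidableEq dA] [Fintype dB]
    [DecidableEq dB] {ρ : Matrix (dA × dB) (dA × dB) ℂ} (hρ : ρ.PosSemidef) (v : dB → ℂ) :
    (condState ρ (ketbra v v)).PosSemidef := by
  rw [condState, ptrB_one_kronecker_ketbra_mul]
  refine (posSemidef_bContract hρ v).smul ?_
  rw [← Complex.ofReal_inv]
  exact_mod_cast inv_nonneg.2 (pOf_ketbra_nonneg hρ v)

lemma posSemidef_ptrA {dA dB : Type} [Fintype dA] [Fintype dB]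
    {ρ : Matrix (dA × dB) (dA × dB) ℂ} (hρ : ρ.PosSemidef) : (ptrA ρ).PosSemidef := by
  have : ptrA ρ = ∑ a, ρ.submatrix (fun b => (a, b)) (fun b => (a, b)) := by
    ext b b'
    simp [ptrA, Matrix.sum_apply]
  rw [this]
  exact posSemidef_sum _ fun a _ => hρ.submatrix _

/-- The basis of `A ⊗ B` whose vectors are `φ_j a ⊗ e_j`. -/
def conditionalBasis {dA dB : Type} (φ : dB → Matrix dA dA ℂ) (e : dB → dB → ℂ) :
    Matrix (dA × dB) (dA × dB) ℂ :=
  Matrix.of fun x k => φ k.2 x.1 k.1 * e k.2 x.2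

lemma conjTranspose_conditionalBasis_mul_mul_apply_self {dA dB : Type} [Fintype dA] [Fintype dB]
    (φ : dB → Matrix dA dA ℂ) (e : dB → dB → ℂ) (M : Matrix (dA × dB) (dA × dB) ℂ) (k : dA × dB) :
    ((conditionalBasis φ e)ᴴ * M * conditionalBasis φ e) k k =
      ((φ k.2)ᴴ * bContract M (e k.2) (e k.2) * φ k.2) k.1 k.1 := by
  simp only [Matrix.mul_apply, conjTranspose_apply, Fintype.sum_prod_type, conditionalBasis,
    of_apply, Finset.sum_mul, Finset.mul_sum, bContract]
  refine Finset.sum_congr rfl fun a' _ => ?_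
  rw [Finset.sum_comm]
  refine Finset.sum_congr rfl fun a _ => ?_
  rw [Finset.sum_comm]
  refine Finset.sum_congr rfl fun b _ => Finset.sum_congr rfl fun b' _ => ?_
  simp only [star_mul']
  ring

lemma conjTranspose_conditionalBasis_mul_self {dA dB : Type} [Fintype dA] [DecidableEq dA]
    [Fintype dB] [DecidableEq dB] (φ : dB → Matrix dA dA ℂ) (hφ : ∀ j, (φ j)ᴴ * φ j = 1)
    (e : dB → dB → ℂ) (he : OrthoFam e) :
    (conditionalBasis φ e)ᴴ * conditionalBasis φ e = 1 := by
  ext ⟨a, j⟩ ⟨a', j'⟩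
  have h1 : ((conditionalBasis φ e)ᴴ * conditionalBasis φ e) (a, j) (a', j') =
      ((φ j)ᴴ * φ j') a a' * ∑ b, star (e j b) * e j' b := by
    simp only [Matrix.mul_apply, conjTranspose_apply, Fintype.sum_prod_type, conditionalBasis,
      of_apply, Finset.sum_mul_sum]
    refine Finset.sum_congr rfl fun c _ => Finset.sum_congr rfl fun b _ => ?_
    rw [star_mul']
    ring
  rw [h1, he]
  by_cases h : j = j'
  · subst h
    simp [hφ, Matrix.one_apply]
  · simp [h]

lemma bContract_one_kronecker {dA dB : Type} [DecidableEq dA] [Fintype dA] [Fintype dB]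
    (ρ : Matrix (dA × dB) (dA × dB) ℂ) (v : dB → ℂ) :
    bContract ((1 : Matrix dA dA ℂ) ⊗ₖ ptrA ρ) v v = (bContract ρ v v).trace • 1 := by
  ext a a'
  have h : (bContract ρ v v).trace = ∑ b, ∑ b', star (v b) * ptrA ρ b b' * v b' := by
    simp only [Matrix.trace, diag_apply, bContract, ptrA, Finset.mul_sum, Finset.sum_mul]
    rw [Finset.sum_comm]
    refine Finset.sum_congr rfl fun b _ => ?_
    rw [Finset.sum_comm]
  rw [h]
  by_cases ha : a = a'
  · simp [bContract, kroneckerMap_apply, ha]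
  · simp [bContract, kroneckerMap_apply, ha]

lemma sum_conjTranspose_one_kronecker_mul_mul_apply {dA dB : Type} [DecidableEq dA] [Fintype dA]
    [Fintype dB] (ρ : Matrix (dA × dB) (dA × dB) ℂ) (W : Matrix dB dB ℂ) (b : dB) :
    ∑ a, (((1 : Matrix dA dA ℂ) ⊗ₖ W)ᴴ * ρ * ((1 : Matrix dA dA ℂ) ⊗ₖ W)) (a, b) (a, b) =
      (Wᴴ * ptrA ρ * W) b b := by
  simp only [Matrix.mul_apply, conjTranspose_apply, Fintype.sum_prod_type, kroneckerMap_apply,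
    Matrix.one_apply, ptrA, Finset.sum_mul, Finset.mul_sum]
  have (a : dA) : ∑ c, ∑ d, ∑ c', ∑ d', star ((if c' = a then 1 else 0) * W d' b) *
      ρ (c', d') (c, d) * ((if c = a then 1 else 0) * W d b) =
      ∑ d, ∑ d', star (W d' b) * ρ (a, d') (a, d) * W d b := by
    rw [Finset.sum_eq_single a (by intro c _ hc; simp [hc]) (by simp)]
    refine Finset.sum_congr rfl fun d _ => ?_
    rw [Finset.sum_eq_single a (by intro c _ hc; simp [hc]) (by simp)]
    simp
  simp only [this]
  rw [Finset.sum_comm]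
  refine Finset.sum_congr rfl fun d _ => ?_
  rw [Finset.sum_comm]

theorem measured_cond_entropy_ge {dA dB : Type} [Fintype dA] [DecidableEq dA] [Fintype dB] [DecidableEq dB]
    (ρ : Matrix (dA × dB) (dA × dB) ℂ) (hρ : IsDensity ρ)
    (e : dB → dB → ℂ) (he : OrthoFam e) :
    ∑ j, pOf ρ (ketbra (e j) (e j)) * vNEntropy (condState ρ (ketbra (e j) (e j))) ≥
      vNEntropy ρ - vNEntropy (ptrA ρ) := by
  obtain ⟨hρ, -⟩ := hρ
  have hB := posSemidef_ptrA hρ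
  have hC := fun j => posSemidef_condState_ketbra hρ (e j)
  set P : dB → ℝ := fun j => pOf ρ (ketbra (e j) (e j)) with hP
  set V : Matrix (dA × dB) (dA × dB) ℂ := hρ.1.eigenvectorUnitary.1 with hV
  set p := hρ.1.eigenvalues with hp
  set W : Matrix dB dB ℂ := hB.1.eigenvectorUnitary.1 with hW
  set q := hB.1.eigenvalues with hq
  set φ : dB → Matrix dA dA ℂ := fun j => (hC j).1.eigenvectorUnitary.1 with hφ
  set l : dB → dA → ℝ := fun j => (hC j).1.eigenvalues with hl
  have hVu : Vᴴ * V = 1 := Unitary.coe_star_mul_self hρ.1.eigenvectorUnitary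
  have hWu : Wᴴ * W = 1 := Unitary.coe_star_mul_self hB.1.eigenvectorUnitary
  have hφu : ∀ j, (φ j)ᴴ * φ j = 1 := fun j =>
    Unitary.coe_star_mul_self (hC j).1.eigenvectorUnitary
  set Φ := conditionalBasis φ e with hΦ
  have hΦu : Φᴴ * Φ = 1 := conjTranspose_conditionalBasis_mul_self φ hφu e he
  have hΦu' : Φ * Φᴴ = 1 := mul_eq_one_comm.1 hΦu
  set Y : Matrix (dA × dB) (dA × dB) ℂ := (1 : Matrix dA dA ℂ) ⊗ₖ W with hY
  have hYu : Y * Yᴴ = 1 := by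
    rw [hY, conjTranspose_kronecker, ← mul_kronecker_mul, mul_eq_one_comm.1 hWu]
    simp
  have hρV : ρ = V * diagonal (fun i => (p i : ℂ)) * Vᴴ := hρ.1.eq_eigenvectorUnitary_mul
  have hBW : ptrA ρ = W * diagonal (fun i => (q i : ℂ)) * Wᴴ := hB.1.eq_eigenvectorUnitary_mul
  have hσ : (1 : Matrix dA dA ℂ) ⊗ₖ ptrA ρ =
      Y * diagonal (fun x : dA × dB => (q x.2 : ℂ)) * Yᴴ := by
    have hd : diagonal (fun x : dA × dB => (q x.2 : ℂ)) =
        (1 : Matrix dA dA ℂ) ⊗ₖ diagonal (fun b => (q b : ℂ)) := by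
      rw [← diagonal_one, diagonal_kronecker_diagonal]
      simp
    rw [hd, hY, conjTranspose_kronecker, ← mul_kronecker_mul, ← mul_kronecker_mul, ← hBW]
    simp
  have hAB : Yᴴ * Φ * (Φᴴ * V) = Yᴴ * V := by
    rw [Matrix.mul_assoc, ← Matrix.mul_assoc Φ, hΦu', Matrix.one_mul]
  have hq_sum : ∀ b, ∑ a, ∑ i, p i * ‖(Yᴴ * V) (a, b) i‖ ^ 2 = q b := by
    intro b
    have h := sum_conjTranspose_one_kronecker_mul_mul_apply ρ W b
    have hWW : Wᴴ * ptrA ρ * W = diagonal fun b => (q b : ℂ) := by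
      rw [hBW]
      calc _ = (Wᴴ * W) * diagonal (fun b => (q b : ℂ)) * (Wᴴ * W) := by
            simp only [Matrix.mul_assoc]
        _ = _ := by rw [hWu]; simp
    rw [hWW, diagonal_apply_eq, ← hY] at h
    conv_lhs at h => rw [hρV]
    simp only [conjTranspose_mul_mul_apply_self] at h
    exact_mod_cast h
  have hr : ∀ k : dA × dB, P k.2 * l k.2 k.1 = ∑ i, p i * ‖(Φᴴ * V) k i‖ ^ 2 := by
    intro k
    have h := conjTranspose_conditionalBasis_mul_mul_apply_self φ e ρ k
    have hCC : (φ k.2)ᴴ * condState ρ (ketbra (e k.2) (e k.2)) * φ k.2 =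
        diagonal fun a => (l k.2 a : ℂ) := by
      conv_lhs => rw [(hC k.2).1.eq_eigenvectorUnitary_mul]
      calc _ = ((φ k.2)ᴴ * φ k.2) * diagonal (fun a => (l k.2 a : ℂ)) *
            ((φ k.2)ᴴ * φ k.2) := by simp only [Matrix.mul_assoc, hφ, hl]
        _ = _ := by rw [hφu]; simp
    rw [← pOf_smul_condState_ketbra hρ, Matrix.mul_smul, Matrix.smul_mul, hCC, Matrix.smul_apply,
      diagonal_apply_eq, ← hΦ] at h
    conv_lhs at h => rw [hρV]
    rw [conjTranspose_mul_mul_apply_self] at h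
    simp only [smul_eq_mul] at h
    exact_mod_cast h.symm
  have hs : ∀ k : dA × dB, P k.2 = ∑ m : dA × dB, q m.2 * ‖(Yᴴ * Φ) m k‖ ^ 2 := by
    intro k
    have h := conjTranspose_conditionalBasis_mul_mul_apply_self φ e
      ((1 : Matrix dA dA ℂ) ⊗ₖ ptrA ρ) k
    rw [bContract_one_kronecker, ← ofReal_pOf_ketbra hρ, Matrix.mul_smul, Matrix.mul_one,
      Matrix.smul_mul, hφu, Matrix.smul_apply, one_apply_eq, hσ, ← hΦ,
      conjTranspose_mul_mul_apply_self Φ Y (fun x : dA × dB => q x.2)] at h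
    have hflip : ∀ m, ‖(Φᴴ * Y) k m‖ = ‖(Yᴴ * Φ) m k‖ := fun m => by
      rw [← norm_star, ← conjTranspose_apply, conjTranspose_mul, conjTranspose_conjTranspose]
    simp only [hflip, smul_eq_mul, mul_one] at h
    exact_mod_cast h.symm
  have hp0 : ∀ i, 0 ≤ p i := hρ.eigenvalues_nonneg
  have hterm : ∀ m i, 0 ≤ p i * ‖(Yᴴ * V) m i‖ ^ 2 := fun m i =>
    mul_nonneg (hp0 i) (by positivity)
  have main := measured_relative_entropy_le (Yᴴ * Φ) (Φᴴ * V)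
    (by rw [conjTranspose_mul, conjTranspose_conjTranspose, Matrix.mul_assoc,
          ← Matrix.mul_assoc Y, hYu, Matrix.one_mul, hΦu])
    (by rw [conjTranspose_mul, conjTranspose_conjTranspose, Matrix.mul_assoc,
          ← Matrix.mul_assoc V, mul_eq_one_comm.1 hVu, Matrix.one_mul, hΦu])
    p (fun m => q m.2) hp0 (fun m => hB.eigenvalues_nonneg m.2)
    (fun k => P k.2 * l k.2 k.1) (fun k => P k.2) hr hs
    (by
      intro m i hm
      rw [hAB]
      have h := hq_sum m.2
      rw [show q m.2 = 0 from hm, Finset.sum_eq_zero_iff_of_nonneg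
        fun a _ => Finset.sum_nonneg fun i _ => hterm _ i] at h
      have h2 := h m.1 (Finset.mem_univ _)
      rw [Finset.sum_eq_zero_iff_of_nonneg fun i _ => hterm _ i] at h2
      exact h2 i (Finset.mem_univ _))
    (by intro k hk; simp [hk])
  rw [hAB] at main
  simp only [Fintype.sum_prod_type_right (f := fun m : dA × dB =>
    (∑ i, p i * ‖(Yᴴ * V) m i‖ ^ 2) * Real.log (q m.2)), ← Finset.sum_mul, hq_sum] at main
  have hlhs : ∑ j, P j * vNEntropy (condState ρ (ketbra (e j) (e j))) =
      ∑ k : dA × dB, P k.2 * l k.2 k.1 * Real.log (P k.2) -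
      ∑ k : dA × dB, P k.2 * l k.2 k.1 * Real.log (P k.2 * l k.2 k.1) := by
    rw [← Finset.sum_sub_distrib, Fintype.sum_prod_type_right]
    refine Finset.sum_congr rfl fun j _ => ?_
    rw [vNEntropy, dif_pos (hC j).1, Finset.mul_sum]
    refine Finset.sum_congr rfl fun a _ => ?_
    change P j * Real.negMulLog (l j a) = _
    by_cases h1 : P j = 0
    · simp [h1]
    by_cases h2 : l j a = 0
    · simp [h2]
    rw [Real.log_mul h1 h2, Real.negMulLog]
    ring
  have hSρ : vNEntropy ρ = - ∑ i, p i * Real.log (p i) := by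
    rw [vNEntropy, dif_pos hρ.1, ← Finset.sum_neg_distrib]
    exact Finset.sum_congr rfl fun i _ => by rw [Real.negMulLog, neg_mul]
  have hSB : vNEntropy (ptrA ρ) = - ∑ b, q b * Real.log (q b) := by
    rw [vNEntropy, dif_pos hB.1, ← Finset.sum_neg_distrib]
    exact Finset.sum_congr rfl fun i _ => by rw [Real.negMulLog, neg_mul]
  rw [hlhs, hSρ, hSB, ge_iff_le]
  linarith

end
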